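/- For every real x ≥ 1, 1 − ∑_{j=−∞}^{∞} (1 − 2 j² x²) e^{−j² x²} ≥ 2 e^{−x²}. -/

import Mathlib

open scoped Real

/-- Right-tail lower bound for the theta distribution: `P(T ≥ x) ≥ 2 e^{-x²}` for `x ≥ 1`,
where `P(T ≤ x) = ∑_{j ∈ ℤ} (1 - 2j²x²) e^{-j²x²}`. -/
theorem theta_right_tail_lower_bound (x : ℝ) (hx : 1 ≤ x) :
    2 * Real.exp (-x ^ 2)
      ≤ 1 - ∑' j : ℤ, (1 - 2 * (j : ℝ) ^ 2 * x ^ 2) * Real.exp (-(j : ℝ) ^ 2 * x ^ 2) := by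
  have hx2 : 1 ≤ x ^ 2 := by nlinarith
  by_cases hs : Summable (fun j : ℤ =>
      (1 - 2 * (j : ℝ) ^ 2 * x ^ 2) * Real.exp (-(j : ℝ) ^ 2 * x ^ 2))
  · have h := hs.neg.sum_le_tsum ({-1, 0, 1} : Finset ℤ) (by
      intro j hj
      have hj0 : j ≠ 0 := by rintro rfl; simp at hj
      have h1 : (1 : ℝ) ≤ (j : ℝ) ^ 2 := by
        have : 1 ≤ j ^ 2 := Int.add_one_le_iff.mpr (sq_pos_of_ne_zero hj0)
        exact_mod_cast this
      rw [← neg_mul]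
      apply mul_nonneg _ (Real.exp_pos _).le
      nlinarith)
    rw [tsum_neg] at h
    rw [Finset.sum_insert (by decide), Finset.sum_insert (by decide), Finset.sum_singleton] at h
    norm_num at h
    have := mul_nonneg (sub_nonneg.mpr hx2) (Real.exp_pos (-x ^ 2)).le
    norm_num at this ⊢
    linarith
  · rw [tsum_eq_zero_of_not_summable hs]
    have h1 : Real.exp (-x ^ 2) * Real.exp (x ^ 2) = 1 := by
      rw [← Real.exp_add]; simp
    have h2 := Real.add_one_le_exp (x ^ 2)
    nlinarith [Real.exp_pos (-x ^ 2)]
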